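/- arXiv:1904.11156 — 2 statements merged into one kernel-verified Lean document; each statement's English description precedes it below -/
import Mathlib

section
/- Let Ψ be a real T×P matrix with Ψ'Ψ invertible and m := λ_min(Ψ'Ψ/T) > 0. Let F ∈ ℝ^T be a fixed vector and β₀ ∈ ℝ^P a fixed vector, and set N := max_{1≤t≤T} |F_t − (Ψβ₀)_t|. Let ε₁,…,εₙ be random vectors in ℝ^T, uncorrelated across i, with mean zero and covariance matrices Σᵢ; set Σ̄ = (1/n)∑ᵢ Σᵢ, ε̄ = (1/n)∑ᵢ εᵢ, Ȳ = F + ε̄, and β̂ = (Ψ'Ψ)⁻¹Ψ'Ȳ. Then E‖β̂ − β₀‖ ≤ ( min(P·λ_max(Σ̄), tr(Σ̄)) / (n·T·m) )^{1/2} + N / m^{1/2}. -/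
open MeasureTheory Matrix
open scoped BigOperators

/-- Smallest eigenvalue of a symmetric matrix, via the Rayleigh quotient
(Courant–Fischer characterization). -/
noncomputable def eigMin {m : Type*} [Fintype m] (M : Matrix m m ℝ) : ℝ :=
  sInf {r : ℝ | ∃ x : m → ℝ, x ⬝ᵥ x = 1 ∧ r = x ⬝ᵥ M.mulVec x}

/-- Largest eigenvalue of a symmetric matrix, via the Rayleigh quotient. -/
noncomputable def eigMax {m : Type*} [Fintype m] (M : Matrix m m ℝ) : ℝ :=
  sSup {r : ℝ | ∃ x : m → ℝ, x ⬝ᵥ x = 1 ∧ r = x ⬝ᵥ M.mulVec x}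

section Eigen

variable {m : Type*} [Fintype m]

lemma dotProduct_self_eq_one_of_normalize {x : m → ℝ} (hx : 0 < x ⬝ᵥ x) :
    ((Real.sqrt (x ⬝ᵥ x))⁻¹ • x) ⬝ᵥ ((Real.sqrt (x ⬝ᵥ x))⁻¹ • x) = 1 := by
  have h := Real.mul_self_sqrt hx.le
  have h0 := (Real.sqrt_pos.2 hx).ne'
  simp only [smul_dotProduct, dotProduct_smul, smul_eq_mul]
  field_simp
  rw [sq, h]

lemma dotProduct_mulVec_normalize (M : Matrix m m ℝ) {x : m → ℝ} (hx : 0 < x ⬝ᵥ x) :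
    ((Real.sqrt (x ⬝ᵥ x))⁻¹ • x) ⬝ᵥ M.mulVec ((Real.sqrt (x ⬝ᵥ x))⁻¹ • x) =
      x ⬝ᵥ M.mulVec x / (x ⬝ᵥ x) := by
  have h := Real.sq_sqrt hx.le
  simp only [smul_dotProduct, dotProduct_smul, mulVec_smul, smul_eq_mul]
  rw [← mul_assoc, ← mul_inv, ← sq, h]
  ring

lemma dotProduct_self_nonneg_real (x : m → ℝ) : 0 ≤ x ⬝ᵥ x :=
  Finset.sum_nonneg fun i _ => mul_self_nonneg (x i)

lemma eigMin_mul_le {M : Matrix m m ℝ} (hM : 0 < eigMin M) (x : m → ℝ) :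
    eigMin M * (x ⬝ᵥ x) ≤ x ⬝ᵥ M.mulVec x := by
  rcases (dotProduct_self_nonneg_real x).eq_or_lt with h | h
  · have : x = 0 := dotProduct_self_eq_zero.1 h.symm
    simp [this]
  · rw [← le_div_iff₀ h]
    refine csInf_le ?_ ⟨_, dotProduct_self_eq_one_of_normalize h,
      (dotProduct_mulVec_normalize M h).symm⟩
    by_contra hb
    exact hM.ne' (Real.sInf_of_not_bddBelow hb)

lemma bddAbove_rayleigh (M : Matrix m m ℝ) :
    BddAbove {r : ℝ | ∃ x : m → ℝ, x ⬝ᵥ x = 1 ∧ r = x ⬝ᵥ M.mulVec x} := by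
  refine ⟨∑ i, ∑ j, |M i j|, ?_⟩
  rintro _ ⟨x, hx, rfl⟩
  have hx1 (i : m) : |x i| ≤ 1 := by
    rw [← sq_le_one_iff_abs_le_one, ← hx, sq]
    exact Finset.single_le_sum (f := fun i => x i * x i)
      (fun i _ => mul_self_nonneg _) (Finset.mem_univ i)
  simp only [dotProduct, mulVec, Finset.mul_sum]
  refine Finset.sum_le_sum fun i _ => Finset.sum_le_sum fun j _ => ?_
  calc x i * (M i j * x j) ≤ |x i * (M i j * x j)| := le_abs_self _
    _ = |M i j| * (|x i| * |x j|) := by rw [abs_mul, abs_mul]; ring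
    _ ≤ |M i j| * 1 := by
      gcongr
      exact mul_le_one₀ (hx1 i) (abs_nonneg _) (hx1 j)
    _ = _ := mul_one _

lemma le_eigMax_mul (M : Matrix m m ℝ) (x : m → ℝ) :
    x ⬝ᵥ M.mulVec x ≤ eigMax M * (x ⬝ᵥ x) := by
  rcases (dotProduct_self_nonneg_real x).eq_or_lt with h | h
  · have : x = 0 := dotProduct_self_eq_zero.1 h.symm
    simp [this]
  · rw [← div_le_iff₀ h]
    exact le_csSup (bddAbove_rayleigh M) ⟨_, dotProduct_self_eq_one_of_normalize h,
      (dotProduct_mulVec_normalize M h).symm⟩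

lemma sqrt_dotProduct_self_eq_norm (x : m → ℝ) :
    Real.sqrt (x ⬝ᵥ x) = ‖WithLp.toLp 2 x‖ := by
  rw [EuclideanSpace.norm_eq]
  simp [dotProduct, sq]

lemma sqrt_dotProduct_self_add_le (x y : m → ℝ) :
    Real.sqrt ((x + y) ⬝ᵥ (x + y)) ≤ Real.sqrt (x ⬝ᵥ x) + Real.sqrt (y ⬝ᵥ y) := by
  simp only [sqrt_dotProduct_self_eq_norm, WithLp.toLp_add]
  exact norm_add_le _ _

end Eigen

section Projection

variable {T P : Type*} [Fintype T] [Fintype P] [DecidableEq P] {Ψ : Matrix T P ℝ}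

/-- The orthogonal projection onto the column space of a design matrix. -/
noncomputable def hatMatrix (Ψ : Matrix T P ℝ) : Matrix T T ℝ := Ψ * ((Ψᵀ * Ψ)⁻¹ * Ψᵀ)

lemma hatMatrix_transpose (Ψ : Matrix T P ℝ) : (hatMatrix Ψ)ᵀ = hatMatrix Ψ := by
  simp [hatMatrix, transpose_mul, transpose_nonsing_inv, Matrix.mul_assoc]

lemma hatMatrix_mul_self (hΨ : IsUnit (Ψᵀ * Ψ).det) :
    hatMatrix Ψ * hatMatrix Ψ = hatMatrix Ψ := by
  have h : (Ψᵀ * Ψ)⁻¹ * (Ψᵀ * Ψ) = 1 := nonsing_inv_mul _ hΨ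
  calc hatMatrix Ψ * hatMatrix Ψ
      = Ψ * (((Ψᵀ * Ψ)⁻¹ * (Ψᵀ * Ψ)) * ((Ψᵀ * Ψ)⁻¹ * Ψᵀ)) := by
        simp only [hatMatrix, Matrix.mul_assoc]
    _ = hatMatrix Ψ := by rw [h, Matrix.one_mul, hatMatrix]

lemma trace_hatMatrix (hΨ : IsUnit (Ψᵀ * Ψ).det) :
    (hatMatrix Ψ).trace = Fintype.card P := by
  rw [hatMatrix, trace_mul_comm, Matrix.mul_assoc, nonsing_inv_mul _ hΨ, trace_one]

lemma sum_row_dotProduct_hatMatrix (hΨ : IsUnit (Ψᵀ * Ψ).det) :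
    ∑ t, hatMatrix Ψ t ⬝ᵥ hatMatrix Ψ t = Fintype.card P := by
  rw [← trace_hatMatrix hΨ]
  conv_rhs => rw [← hatMatrix_mul_self hΨ]
  conv_rhs => enter [1, 2]; rw [← hatMatrix_transpose]
  rfl

lemma hatMatrix_mulVec_dotProduct_self (hΨ : IsUnit (Ψᵀ * Ψ).det) (v : T → ℝ) :
    (hatMatrix Ψ).mulVec v ⬝ᵥ (hatMatrix Ψ).mulVec v = v ⬝ᵥ (hatMatrix Ψ).mulVec v := by
  rw [dotProduct_mulVec, vecMul_mulVec, hatMatrix_transpose, hatMatrix_mul_self hΨ,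
    ← dotProduct_mulVec]

lemma hatMatrix_mulVec_le (hΨ : IsUnit (Ψᵀ * Ψ).det) (v : T → ℝ) :
    (hatMatrix Ψ).mulVec v ⬝ᵥ (hatMatrix Ψ).mulVec v ≤ v ⬝ᵥ v := by
  have h := dotProduct_self_nonneg_real (v - (hatMatrix Ψ).mulVec v)
  rw [sub_dotProduct, dotProduct_sub, dotProduct_sub, hatMatrix_mulVec_dotProduct_self hΨ,
    dotProduct_comm ((hatMatrix Ψ).mulVec v) v] at h
  rw [hatMatrix_mulVec_dotProduct_self hΨ]
  linarith

lemma leastSquares_dotProduct_self_le {c : ℝ} (hc : 0 < c)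
    (hm : 0 < eigMin (c⁻¹ • (Ψᵀ * Ψ))) (v : T → ℝ) :
    ((Ψᵀ * Ψ)⁻¹ * Ψᵀ).mulVec v ⬝ᵥ ((Ψᵀ * Ψ)⁻¹ * Ψᵀ).mulVec v ≤
      (hatMatrix Ψ).mulVec v ⬝ᵥ (hatMatrix Ψ).mulVec v / (c * eigMin (c⁻¹ • (Ψᵀ * Ψ))) := by
  set G := (Ψᵀ * Ψ)⁻¹ * Ψᵀ with hG
  have h := eigMin_mul_le hm (G.mulVec v)
  have e : (hatMatrix Ψ).mulVec v ⬝ᵥ (hatMatrix Ψ).mulVec v =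
      G.mulVec v ⬝ᵥ (Ψᵀ * Ψ).mulVec (G.mulVec v) := by
    rw [hatMatrix, ← hG, ← mulVec_mulVec, ← mulVec_mulVec (G.mulVec v), dotProduct_mulVec _ Ψᵀ,
      vecMul_transpose]
  rw [smul_mulVec, dotProduct_smul, ← e, smul_eq_mul, le_inv_mul_iff₀ hc] at h
  rw [le_div_iff₀ (by positivity)]
  linarith

end Projection

section SecondMoment

variable {Ω : Type*} [MeasurableSpace Ω] {μ : Measure Ω}
  {T S : Type*} [Fintype T] [Fintype S] {Z : Ω → T → ℝ} {C : Matrix T T ℝ}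

lemma dotProduct_mul_self_eq_sum (h z : T → ℝ) :
    (h ⬝ᵥ z) * (h ⬝ᵥ z) = ∑ s, ∑ s', h s * h s' * (z s * z s') := by
  simp only [dotProduct, Finset.sum_mul_sum]
  exact Finset.sum_congr rfl fun _ _ => Finset.sum_congr rfl fun _ _ => by ring

lemma integrable_dotProduct_mul_self
    (hint : ∀ s s', Integrable (fun ω => Z ω s * Z ω s') μ) (h : T → ℝ) :
    Integrable (fun ω => (h ⬝ᵥ Z ω) * (h ⬝ᵥ Z ω)) μ := by
  simp only [dotProduct_mul_self_eq_sum]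
  exact integrable_finsetSum _ fun s _ => integrable_finsetSum _ fun s' _ =>
    (hint s s').const_mul _

lemma integral_dotProduct_mul_self
    (hint : ∀ s s', Integrable (fun ω => Z ω s * Z ω s') μ)
    (hC : ∀ s s', ∫ ω, Z ω s * Z ω s' ∂μ = C s s') (h : T → ℝ) :
    ∫ ω, (h ⬝ᵥ Z ω) * (h ⬝ᵥ Z ω) ∂μ = h ⬝ᵥ C.mulVec h := by
  simp only [dotProduct_mul_self_eq_sum]
  rw [integral_finsetSum _ fun s _ => integrable_finsetSum _ fun s' _ => (hint s s').const_mul _]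
  simp only [dotProduct, mulVec, Finset.mul_sum]
  refine Finset.sum_congr rfl fun s _ => ?_
  rw [integral_finsetSum _ fun s' _ => (hint s s').const_mul _]
  refine Finset.sum_congr rfl fun s' _ => ?_
  rw [integral_const_mul, hC]
  ring

lemma integrable_mulVec_dotProduct_self
    (hint : ∀ s s', Integrable (fun ω => Z ω s * Z ω s') μ) (H : Matrix S T ℝ) :
    Integrable (fun ω => H.mulVec (Z ω) ⬝ᵥ H.mulVec (Z ω)) μ :=
  integrable_finsetSum _ fun s _ => integrable_dotProduct_mul_self hint (H s)

lemma integral_mulVec_dotProduct_self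
    (hint : ∀ s s', Integrable (fun ω => Z ω s * Z ω s') μ)
    (hC : ∀ s s', ∫ ω, Z ω s * Z ω s' ∂μ = C s s') (H : Matrix S T ℝ) :
    ∫ ω, H.mulVec (Z ω) ⬝ᵥ H.mulVec (Z ω) ∂μ = ∑ s, H s ⬝ᵥ C.mulVec (H s) := by
  rw [← Finset.sum_congr rfl fun s _ => integral_dotProduct_mul_self hint hC (H s)]
  exact integral_finsetSum _ fun s _ => integrable_dotProduct_mul_self hint (H s)

lemma integral_sqrt_le_sqrt_integral [IsProbabilityMeasure μ] {g : Ω → ℝ}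
    (hg : Integrable g μ) (h0 : ∀ ω, 0 ≤ g ω) :
    Integrable (fun ω => Real.sqrt (g ω)) μ ∧
      ∫ ω, Real.sqrt (g ω) ∂μ ≤ Real.sqrt (∫ ω, g ω ∂μ) := by
  have hm : AEStronglyMeasurable (fun ω => Real.sqrt (g ω)) μ :=
    Real.continuous_sqrt.comp_aestronglyMeasurable hg.1
  have hsq : (fun ω => Real.sqrt (g ω)) ^ 2 = g := funext fun ω => Real.sq_sqrt (h0 ω)
  have h2 : MemLp (fun ω => Real.sqrt (g ω)) 2 μ := by
    rw [memLp_two_iff_integrable_sq hm]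
    simpa only [Real.sq_sqrt (h0 _)] using hg
  refine ⟨h2.integrable (by norm_num), Real.le_sqrt_of_sq_le ?_⟩
  have hv := ProbabilityTheory.variance_nonneg (fun ω => Real.sqrt (g ω)) μ
  rw [ProbabilityTheory.variance_eq_sub h2, hsq] at hv
  linarith

/-- The projected second moment is bounded both by rank times the largest eigenvalue
and by the trace. -/
lemma integral_hatMatrix_mulVec_le {P : Type*} [Fintype P] [DecidableEq P] {Ψ : Matrix T P ℝ}
    (hΨ : IsUnit (Ψᵀ * Ψ).det) {a : ℝ} (ha : 0 ≤ a)
    (hint : ∀ s s', Integrable (fun ω => Z ω s * Z ω s') μ)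
    (hC : ∀ s s', ∫ ω, Z ω s * Z ω s' ∂μ = (a • C) s s') :
    ∫ ω, (hatMatrix Ψ).mulVec (Z ω) ⬝ᵥ (hatMatrix Ψ).mulVec (Z ω) ∂μ ≤
      a * min (Fintype.card P * eigMax C) C.trace := by
  rw [mul_min_of_nonneg _ _ ha]
  refine le_min ?_ ?_
  · rw [integral_mulVec_dotProduct_self hint hC, ← sum_row_dotProduct_hatMatrix hΨ,
      Finset.sum_mul, Finset.mul_sum]
    refine Finset.sum_le_sum fun s _ => ?_
    rw [smul_mulVec, dotProduct_smul, smul_eq_mul, mul_comm _ (eigMax C)]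
    gcongr
    exact le_eigMax_mul C _
  · have hZ : Integrable (fun ω => Z ω ⬝ᵥ Z ω) μ := integrable_finsetSum _ fun s _ => hint s s
    refine (integral_mono (integrable_mulVec_dotProduct_self hint _) hZ
      fun ω => hatMatrix_mulVec_le hΨ (Z ω)).trans_eq ?_
    simp only [dotProduct]
    rw [integral_finsetSum _ fun s _ => hint s s]
    simp [hC, trace, Finset.mul_sum]

end SecondMoment

section Mean

variable {Ω : Type*} [MeasurableSpace Ω] {μ : Measure Ω} {T : Type*}

lemma integrable_mean_mul_mean {n : ℕ} {ε : Fin n → Ω → T → ℝ}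
    (hint : ∀ i i' t t', Integrable (fun ω => ε i ω t * ε i' ω t') μ) (s s' : T) :
    Integrable (fun ω => ((n : ℝ)⁻¹ * ∑ i, ε i ω s) * ((n : ℝ)⁻¹ * ∑ i, ε i ω s')) μ := by
  simp only [mul_mul_mul_comm _ (∑ i, ε i _ s), Finset.sum_mul_sum]
  exact (integrable_finsetSum _ fun i _ => integrable_finsetSum _ fun i' _ =>
    hint i i' s s').const_mul _

lemma integral_mean_mul_mean {n : ℕ} {ε : Fin n → Ω → T → ℝ} {Sigm : Fin n → Matrix T T ℝ}
    (hint : ∀ i i' t t', Integrable (fun ω => ε i ω t * ε i' ω t') μ)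
    (hcov : ∀ i t t', ∫ ω, ε i ω t * ε i ω t' ∂μ = Sigm i t t')
    (huncorr : ∀ i i', i ≠ i' → ∀ t t', ∫ ω, ε i ω t * ε i' ω t' ∂μ = 0) (s s' : T) :
    ∫ ω, ((n : ℝ)⁻¹ * ∑ i, ε i ω s) * ((n : ℝ)⁻¹ * ∑ i, ε i ω s') ∂μ =
      ((n : ℝ)⁻¹ • ((n : ℝ)⁻¹ • ∑ i, Sigm i)) s s' := by
  simp only [mul_mul_mul_comm _ (∑ i, ε i _ s), Finset.sum_mul_sum]
  rw [integral_const_mul, integral_finsetSum _ fun i _ => integrable_finsetSum _ fun i' _ =>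
    hint i i' s s']
  simp only [Matrix.smul_apply, smul_eq_mul, ← mul_assoc, Matrix.sum_apply]
  congr 1
  refine Finset.sum_congr rfl fun i _ => ?_
  rw [integral_finsetSum _ fun i' _ => hint i i' s s', ← hcov]
  exact Finset.sum_eq_single i (fun i' _ h => huncorr i i' h.symm s s') (by simp)

end Mean

theorem sieve_coefficient_bound
    {Ω : Type*} [MeasurableSpace Ω] (μ : Measure Ω) [IsProbabilityMeasure μ]
    (T P n : ℕ) (hT : 0 < T) (hP : 0 < P) (hn : 0 < n)
    (Ψ : Matrix (Fin T) (Fin P) ℝ) (hΨ : IsUnit (Ψᵀ * Ψ).det)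
    (hm : 0 < eigMin ((T : ℝ)⁻¹ • (Ψᵀ * Ψ)))
    (F : Fin T → ℝ) (β₀ : Fin P → ℝ)
    (ε : Fin n → Ω → Fin T → ℝ) (Sigm : Fin n → Matrix (Fin T) (Fin T) ℝ)
    (hmeas : ∀ i, Measurable (ε i))
    (hint : ∀ i i' t t', Integrable (fun ω => ε i ω t * ε i' ω t') μ)
    (hmean : ∀ i t, ∫ ω, ε i ω t ∂μ = 0)
    (hcov : ∀ i t t', ∫ ω, ε i ω t * ε i ω t' ∂μ = Sigm i t t')
    (huncorr : ∀ i i', i ≠ i' → ∀ t t', ∫ ω, ε i ω t * ε i' ω t' ∂μ = 0)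
    (βhat : Ω → Fin P → ℝ)
    (hβhat : ∀ ω, βhat ω =
      (Ψᵀ * Ψ)⁻¹.mulVec (Ψᵀ.mulVec (fun t => F t + (n : ℝ)⁻¹ * ∑ i, ε i ω t))) :
    ∫ ω, Real.sqrt ((βhat ω - β₀) ⬝ᵥ (βhat ω - β₀)) ∂μ ≤
      Real.sqrt
        (min ((P : ℝ) * eigMax ((n : ℝ)⁻¹ • ∑ i, Sigm i))
            (Matrix.trace ((n : ℝ)⁻¹ • ∑ i, Sigm i)) /
          ((n : ℝ) * (T : ℝ) * eigMin ((T : ℝ)⁻¹ • (Ψᵀ * Ψ)))) +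
      (⨆ t, |F t - Ψ.mulVec β₀ t|) / Real.sqrt (eigMin ((T : ℝ)⁻¹ • (Ψᵀ * Ψ))) := by
  set m := eigMin ((T : ℝ)⁻¹ • (Ψᵀ * Ψ))
  set C := (n : ℝ)⁻¹ • ∑ i, Sigm i
  set G := (Ψᵀ * Ψ)⁻¹ * Ψᵀ with hG_def
  set Z : Ω → Fin T → ℝ := fun ω t => (n : ℝ)⁻¹ * ∑ i, ε i ω t
  set r := F - Ψ.mulVec β₀ with hr_def
  set N := ⨆ t, |F t - Ψ.mulVec β₀ t|
  have hT' : (0 : ℝ) < T := by exact_mod_cast hT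
  have hintZ : ∀ s s', Integrable (fun ω => Z ω s * Z ω s') μ := integrable_mean_mul_mean hint
  have hcovZ : ∀ s s', ∫ ω, Z ω s * Z ω s' ∂μ = ((n : ℝ)⁻¹ • C) s s' :=
    integral_mean_mul_mean hint hcov huncorr
  have hdecomp (ω : Ω) : βhat ω - β₀ = G.mulVec (Z ω) + G.mulVec r := by
    have h : G.mulVec (Ψ.mulVec β₀) = β₀ := by
      rw [mulVec_mulVec, hG_def, Matrix.mul_assoc, nonsing_inv_mul _ hΨ, one_mulVec]
    have hY : (fun t => F t + (n : ℝ)⁻¹ * ∑ i, ε i ω t) = F + Z ω := rfl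
    rw [hβhat, hY, mulVec_mulVec, ← hG_def, hr_def, mulVec_sub, h, mulVec_add]
    abel
  have hbias : Real.sqrt (G.mulVec r ⬝ᵥ G.mulVec r) ≤ N / Real.sqrt m := by
    have hrN (t : Fin T) : |r t| ≤ N :=
      le_ciSup (f := fun t => |F t - Ψ.mulVec β₀ t|) (Set.finite_range _).bddAbove t
    have hN0 : 0 ≤ N := Real.iSup_nonneg fun _ => abs_nonneg _
    have hr : r ⬝ᵥ r ≤ T * N ^ 2 := by
      calc r ⬝ᵥ r ≤ ∑ _t : Fin T, N ^ 2 := Finset.sum_le_sum fun t _ => by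
            rw [← sq, ← sq_abs]
            exact pow_le_pow_left₀ (abs_nonneg _) (hrN t) 2
        _ = T * N ^ 2 := by simp
    rw [← Real.sqrt_sq hN0, ← Real.sqrt_div (sq_nonneg N)]
    refine Real.sqrt_le_sqrt ((leastSquares_dotProduct_self_le hT' hm r).trans ?_)
    calc _ ≤ (T * N ^ 2) / (T * m) := by
          gcongr
          exact (hatMatrix_mulVec_le hΨ r).trans hr
      _ = N ^ 2 / m := by field_simp
  obtain ⟨hX, hXle⟩ := integral_sqrt_le_sqrt_integral (integrable_mulVec_dotProduct_self hintZ G)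
    fun ω => dotProduct_self_nonneg_real _
  have hnoise : ∫ ω, G.mulVec (Z ω) ⬝ᵥ G.mulVec (Z ω) ∂μ ≤
      min ((P : ℝ) * eigMax C) C.trace / (n * T * m) := by
    calc _ ≤ ∫ ω, (hatMatrix Ψ).mulVec (Z ω) ⬝ᵥ (hatMatrix Ψ).mulVec (Z ω) / (T * m) ∂μ :=
          integral_mono (integrable_mulVec_dotProduct_self hintZ G)
            ((integrable_mulVec_dotProduct_self hintZ _).div_const _)
            fun ω => leastSquares_dotProduct_self_le hT' hm (Z ω)
      _ ≤ ((n : ℝ)⁻¹ * min ((P : ℝ) * eigMax C) C.trace) / (T * m) := by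
          rw [integral_div]
          gcongr
          simpa using integral_hatMatrix_mulVec_le hΨ (by positivity) hintZ hcovZ
      _ = _ := by field_simp
  calc _ ≤ ∫ ω, (Real.sqrt (G.mulVec (Z ω) ⬝ᵥ G.mulVec (Z ω)) + N / Real.sqrt m) ∂μ := by
        refine integral_mono_of_nonneg (ae_of_all _ fun _ => Real.sqrt_nonneg _)
          (hX.add (integrable_const _)) (ae_of_all _ fun ω => ?_)
        simp only [hdecomp]
        exact (sqrt_dotProduct_self_add_le _ _).trans (by gcongr)
    _ = ∫ ω, Real.sqrt (G.mulVec (Z ω) ⬝ᵥ G.mulVec (Z ω)) ∂μ + N / Real.sqrt m := by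
        rw [integral_add hX (integrable_const _)]
        simp
    _ ≤ _ := by
        gcongr
        exact hXle.trans (Real.sqrt_le_sqrt hnoise)
end

section
/- Let Ψ be a real T×P matrix with Ψ'Ψ invertible, let Ψ̃ be a real R×P matrix with Ψ̃Ψ̃' positive definite, let Σ̄ be a T×T symmetric positive definite matrix, and let n be a positive integer. Define V := (1/n)·Ψ̃(Ψ'Ψ)⁻¹Ψ'Σ̄Ψ(Ψ'Ψ)⁻¹Ψ̃'. Then λ_min(V) ≥ λ_min(Ψ̃Ψ̃')·λ_min(Σ̄) / ( n·T·λ_max(Ψ'Ψ/T) ) > 0; in particular V is positive definite. -/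
open Matrix
open scoped BigOperators

section Rayleigh

variable {m : Type*} [Fintype m]

theorem isCompact_rayleigh (M : Matrix m m ℝ) :
    IsCompact {r : ℝ | ∃ x : m → ℝ, x ⬝ᵥ x = 1 ∧ r = x ⬝ᵥ M.mulVec x} := by
  have hS : IsCompact {x : m → ℝ | x ⬝ᵥ x = 1} := by
    refine Metric.isCompact_of_isClosed_isBounded
      (isClosed_eq (by fun_prop) continuous_const) ?_
    refine (Metric.isBounded_closedBall (x := (0 : m → ℝ)) (r := 1)).subset fun x hx => ?_
    rw [mem_closedBall_zero_iff, pi_norm_le_iff_of_nonneg zero_le_one]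
    intro i
    have h : x i * x i ≤ ∑ j, x j * x j :=
      Finset.single_le_sum (f := fun j => x j * x j) (fun j _ => mul_self_nonneg _)
        (Finset.mem_univ i)
    have hx' : ∑ j, x j * x j = 1 := hx
    rw [Real.norm_eq_abs]
    exact abs_le_one_iff_mul_self_le_one.mpr (h.trans_eq hx')
  convert hS.image (f := fun x : m → ℝ => x ⬝ᵥ M.mulVec x) (by fun_prop) using 1
  ext r
  exact exists_congr fun x => and_congr_right fun _ => eq_comm

theorem rayleigh_nonempty [Nonempty m] (M : Matrix m m ℝ) :
    {r : ℝ | ∃ x : m → ℝ, x ⬝ᵥ x = 1 ∧ r = x ⬝ᵥ M.mulVec x}.Nonempty := by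
  classical
  obtain ⟨i⟩ := ‹Nonempty m›
  exact ⟨_, Pi.single i 1, by simp, rfl⟩

theorem exists_unit_smul {x : m → ℝ} (hx : x ≠ 0) :
    ∃ c : ℝ, ∃ u : m → ℝ, u ⬝ᵥ u = 1 ∧ x = c • u ∧ x ⬝ᵥ x = c * c := by
  have hpos : 0 < x ⬝ᵥ x :=
    lt_of_le_of_ne (Finset.sum_nonneg fun i _ => mul_self_nonneg _)
      (fun h => hx (dotProduct_self_eq_zero.mp h.symm))
  have hs : √(x ⬝ᵥ x) ≠ 0 := (Real.sqrt_pos.mpr hpos).ne'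
  have hss := Real.mul_self_sqrt hpos.le
  refine ⟨√(x ⬝ᵥ x), (√(x ⬝ᵥ x))⁻¹ • x, ?_, (smul_inv_smul₀ hs x).symm, hss.symm⟩
  rw [smul_dotProduct, dotProduct_smul, smul_eq_mul, smul_eq_mul, ← mul_assoc, ← mul_inv, hss,
    inv_mul_cancel₀ hpos.ne']

theorem eigMin_mul_dotProduct_le (M : Matrix m m ℝ) (x : m → ℝ) :
    eigMin M * (x ⬝ᵥ x) ≤ x ⬝ᵥ M *ᵥ x := by
  rcases eq_or_ne x 0 with rfl | hx
  · simp
  obtain ⟨c, u, hu, rfl, hc⟩ := exists_unit_smul hx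
  have h : eigMin M ≤ u ⬝ᵥ M *ᵥ u := csInf_le (isCompact_rayleigh M).bddBelow ⟨u, hu, rfl⟩
  rw [hc, mulVec_smul, smul_dotProduct, dotProduct_smul, smul_eq_mul, smul_eq_mul]
  nlinarith [mul_le_mul_of_nonneg_left h (mul_self_nonneg c)]

theorem dotProduct_le_eigMax_mul (M : Matrix m m ℝ) (x : m → ℝ) :
    x ⬝ᵥ M *ᵥ x ≤ eigMax M * (x ⬝ᵥ x) := by
  rcases eq_or_ne x 0 with rfl | hx
  · simp
  obtain ⟨c, u, hu, rfl, hc⟩ := exists_unit_smul hx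
  have h : u ⬝ᵥ M *ᵥ u ≤ eigMax M := le_csSup (isCompact_rayleigh M).bddAbove ⟨u, hu, rfl⟩
  rw [hc, mulVec_smul, smul_dotProduct, dotProduct_smul, smul_eq_mul, smul_eq_mul]
  nlinarith [mul_le_mul_of_nonneg_left h (mul_self_nonneg c)]

theorem le_eigMin [Nonempty m] {M : Matrix m m ℝ} {c : ℝ}
    (h : ∀ x : m → ℝ, x ⬝ᵥ x = 1 → c ≤ x ⬝ᵥ M *ᵥ x) : c ≤ eigMin M := by
  refine le_csInf (rayleigh_nonempty M) ?_
  rintro r ⟨x, hx, rfl⟩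
  exact h x hx

theorem Matrix.PosDef.eigMin_pos [Nonempty m] {M : Matrix m m ℝ} (hM : M.PosDef) :
    0 < eigMin M := by
  obtain ⟨x, hx, h⟩ := (isCompact_rayleigh M).sInf_mem (rayleigh_nonempty M)
  have hx0 : x ≠ 0 := by
    rintro rfl
    simp at hx
  exact (hM.dotProduct_mulVec_pos hx0).trans_eq h.symm

theorem Matrix.PosDef.eigMax_pos [Nonempty m] {M : Matrix m m ℝ} (hM : M.PosDef) :
    0 < eigMax M := by
  obtain ⟨r, hr⟩ := rayleigh_nonempty M
  exact hM.eigMin_pos.trans_le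
    ((csInf_le (isCompact_rayleigh M).bddBelow hr).trans
      (le_csSup (isCompact_rayleigh M).bddAbove hr))

theorem Matrix.IsHermitian.posDef_of_eigMin_pos {M : Matrix m m ℝ} (hM : M.IsHermitian)
    (h : 0 < eigMin M) : M.PosDef := by
  refine .of_dotProduct_mulVec_pos hM fun x hx => ?_
  have hpos : 0 < x ⬝ᵥ x :=
    lt_of_le_of_ne (Finset.sum_nonneg fun i _ => mul_self_nonneg _)
      (fun h => hx (dotProduct_self_eq_zero.mp h.symm))
  exact (mul_pos h hpos).trans_le (eigMin_mul_dotProduct_le M x)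

end Rayleigh

theorem dotProduct_gram_mulVec {m k : Type*} [Fintype m] [Fintype k] (A : Matrix m k ℝ)
    (x y : k → ℝ) : x ⬝ᵥ (Aᵀ * A) *ᵥ y = (A *ᵥ x) ⬝ᵥ (A *ᵥ y) := by
  rw [← mulVec_mulVec, dotProduct_mulVec, vecMul_transpose]

theorem posDef_gram_of_isUnit_det {m k : Type*} [Fintype m] [Fintype k] [DecidableEq k]
    {A : Matrix m k ℝ} (hA : IsUnit (Aᵀ * A).det) : (Aᵀ * A).PosDef := by
  have hinj : Function.Injective A.mulVec := by
    intro x y hxy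
    refine mulVec_injective_of_isUnit ((isUnit_iff_isUnit_det _).mpr hA) ?_
    simp only [← mulVec_mulVec]
    exact congrArg _ hxy
  simpa using PosDef.conjTranspose_mul_self A hinj

/-- If `AᵀA ≤ c` in the Loewner order then `(AᵀA)⁻¹ ≥ c⁻¹`, as quadratic forms. -/
theorem dotProduct_self_le_mul_gram_inv {m k : Type*} [Fintype m] [Fintype k] [DecidableEq k]
    {A : Matrix m k ℝ} (hA : IsUnit (Aᵀ * A).det) {c : ℝ} (hc : 0 ≤ c)
    (h : ∀ x, x ⬝ᵥ (Aᵀ * A) *ᵥ x ≤ c * (x ⬝ᵥ x)) (y : k → ℝ) :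
    y ⬝ᵥ y ≤ c * ((A *ᵥ (Aᵀ * A)⁻¹ *ᵥ y) ⬝ᵥ (A *ᵥ (Aᵀ * A)⁻¹ *ᵥ y)) := by
  set w := A *ᵥ (Aᵀ * A)⁻¹ *ᵥ y with hw
  have hyy : y ⬝ᵥ y = (A *ᵥ y) ⬝ᵥ w := by
    rw [hw, ← dotProduct_gram_mulVec, mulVec_mulVec, mul_nonsing_inv _ hA, one_mulVec]
  have hcs : ((A *ᵥ y) ⬝ᵥ w) ^ 2 ≤ ((A *ᵥ y) ⬝ᵥ (A *ᵥ y)) * (w ⬝ᵥ w) := by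
    simpa only [dotProduct, sq] using
      Finset.sum_mul_sq_le_sq_mul_sq Finset.univ (A *ᵥ y) w
  have hy := h y
  rw [dotProduct_gram_mulVec] at hy
  have hw0 : 0 ≤ w ⬝ᵥ w := Finset.sum_nonneg fun i _ => mul_self_nonneg _
  have hy0 : 0 ≤ y ⬝ᵥ y := Finset.sum_nonneg fun i _ => mul_self_nonneg _
  rcases hy0.eq_or_lt with h0 | h0
  · rw [← h0]
    positivity
  · rw [← hyy] at hcs
    refine le_of_mul_le_mul_left ?_ h0
    nlinarith [mul_le_mul_of_nonneg_right hy hw0]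

theorem functional_variance_posdef
    (T P R n : ℕ) (hT : 0 < T) (hP : 0 < P) (hR : 0 < R) (hn : 0 < n)
    (Ψ : Matrix (Fin T) (Fin P) ℝ) (hΨ : IsUnit (Ψᵀ * Ψ).det)
    (Ψt : Matrix (Fin R) (Fin P) ℝ) (hΨt : (Ψt * Ψtᵀ).PosDef)
    (Sb : Matrix (Fin T) (Fin T) ℝ) (hSb : Sb.PosDef)
    (V : Matrix (Fin R) (Fin R) ℝ)
    (hV : V = (n : ℝ)⁻¹ • (Ψt * (Ψᵀ * Ψ)⁻¹ * Ψᵀ * Sb * Ψ * (Ψᵀ * Ψ)⁻¹ * Ψtᵀ)) :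
    eigMin (Ψt * Ψtᵀ) * eigMin Sb /
        ((n : ℝ) * (T : ℝ) * eigMax ((T : ℝ)⁻¹ • (Ψᵀ * Ψ))) ≤ eigMin V ∧
    0 < eigMin (Ψt * Ψtᵀ) * eigMin Sb /
        ((n : ℝ) * (T : ℝ) * eigMax ((T : ℝ)⁻¹ • (Ψᵀ * Ψ))) ∧
    V.PosDef := by
  have : Nonempty (Fin T) := ⟨⟨0, hT⟩⟩
  have : Nonempty (Fin P) := ⟨⟨0, hP⟩⟩
  have : Nonempty (Fin R) := ⟨⟨0, hR⟩⟩
  have hT' : (0 : ℝ) < T := Nat.cast_pos.mpr hT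
  have hn' : (0 : ℝ) < n := Nat.cast_pos.mpr hn
  have ha := hΨt.eigMin_pos
  have hs := hSb.eigMin_pos
  have hL : 0 < eigMax ((T : ℝ)⁻¹ • (Ψᵀ * Ψ)) :=
    ((posDef_gram_of_isUnit_det hΨ).smul (inv_pos.mpr hT')).eigMax_pos
  set a := eigMin (Ψt * Ψtᵀ)
  set s := eigMin Sb
  set L := eigMax ((T : ℝ)⁻¹ • (Ψᵀ * Ψ)) with hLdef
  have hpos : 0 < a * s / (n * T * L) := by positivity
  have hG : ∀ x, x ⬝ᵥ (Ψᵀ * Ψ) *ᵥ x ≤ T * L * (x ⬝ᵥ x) := fun x => by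
    have h := dotProduct_le_eigMax_mul ((T : ℝ)⁻¹ • (Ψᵀ * Ψ)) x
    rw [smul_mulVec, dotProduct_smul, smul_eq_mul, ← hLdef, inv_mul_le_iff₀ hT'] at h
    rwa [mul_assoc]
  have hsym : ((Ψᵀ * Ψ)⁻¹)ᵀ = (Ψᵀ * Ψ)⁻¹ := by
    rw [transpose_nonsing_inv, transpose_mul, transpose_transpose]
  have hVB : V = (n : ℝ)⁻¹ •
      ((Ψ * (Ψᵀ * Ψ)⁻¹ * Ψtᵀ)ᵀ * Sb * (Ψ * (Ψᵀ * Ψ)⁻¹ * Ψtᵀ)) := by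
    rw [hV]
    simp only [transpose_mul, transpose_transpose, hsym, Matrix.mul_assoc]
  have hVherm : V.IsHermitian := by
    have hSt : Sbᵀ = Sb := by simpa using hSb.isHermitian.eq
    rw [IsHermitian, conjTranspose_eq_transpose_of_trivial, hVB, transpose_smul]
    simp only [transpose_mul, transpose_transpose, hSt, Matrix.mul_assoc]
  have hle : a * s / (n * T * L) ≤ eigMin V := by
    refine le_eigMin fun x hx => ?_
    have hy : a ≤ (Ψtᵀ *ᵥ x) ⬝ᵥ (Ψtᵀ *ᵥ x) := by
      rw [← dotProduct_gram_mulVec, transpose_transpose]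
      simpa [hx] using eigMin_mul_dotProduct_le (Ψt * Ψtᵀ) x
    have hw := hy.trans (dotProduct_self_le_mul_gram_inv hΨ (by positivity) hG (Ψtᵀ *ᵥ x))
    have hVx : x ⬝ᵥ V *ᵥ x = (n : ℝ)⁻¹ * ((Ψ *ᵥ (Ψᵀ * Ψ)⁻¹ *ᵥ Ψtᵀ *ᵥ x) ⬝ᵥ
        Sb *ᵥ (Ψ *ᵥ (Ψᵀ * Ψ)⁻¹ *ᵥ Ψtᵀ *ᵥ x)) := by
      rw [hVB, smul_mulVec, dotProduct_smul, smul_eq_mul, Matrix.mul_assoc, ← mulVec_mulVec,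
        dotProduct_mulVec, vecMul_transpose]
      simp only [mulVec_mulVec, Matrix.mul_assoc]
    rw [hVx]
    set w := Ψ *ᵥ (Ψᵀ * Ψ)⁻¹ *ᵥ Ψtᵀ *ᵥ x
    calc a * s / (n * T * L) ≤ T * L * (w ⬝ᵥ w) * s / (n * T * L) := by gcongr
      _ = (n : ℝ)⁻¹ * (s * (w ⬝ᵥ w)) := by field_simp
      _ ≤ (n : ℝ)⁻¹ * (w ⬝ᵥ Sb *ᵥ w) := by
        gcongr
        exact eigMin_mul_dotProduct_le Sb w
  exact ⟨hle, hpos, hVherm.posDef_of_eigMin_pos (hpos.trans_le hle)⟩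
end
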